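/- Let f : [0,π] → ℝ be continuous and define φ(θ) = −(1/F_∞(θ))·∫₀^θ F_∞(θ−α)·F_∞(α)·f(α) dα for θ ∈ [0,π) (so φ(0) = 0). Then φ is differentiable on (0,π) and solves the Poisson equation: for every θ ∈ (0,π), φ′(θ) + ∫₀^θ 2·F(θ−α)·(F_∞(α)/F_∞(θ))·(φ(α) − φ(θ)) dα = −f(θ). (Equation (eq:poissonsolution) in the proof of Proposition 4.7 of the paper.) -/

import Mathlib

open MeasureTheory Real

noncomputable def J0 (x : ℝ) : ℝ :=
  ∑' k : ℕ, (-1 : ℝ) ^ k * (x / 2) ^ (2 * k) / ((Nat.factorial k : ℝ)) ^ 2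

noncomputable def J1 (x : ℝ) : ℝ :=
  ∑' k : ℕ, (-1 : ℝ) ^ k * (x / 2) ^ (2 * k + 1) /
    ((Nat.factorial k : ℝ) * (Nat.factorial (k + 1) : ℝ))

noncomputable def c0 : ℝ := sInf {x : ℝ | 0 < x ∧ J0 x = 0}

/-- `F_∞(θ) = J₀(θ c₀/π)`. -/
noncomputable def Finf (θ : ℝ) : ℝ := J0 (θ * c0 / Real.pi)

/-- The critical generating function `F(x_c; θ) = c₀ J₁(θ c₀/π)/(2πθ)`, with
`F(0) = (c₀/(2π))²`. -/
noncomputable def F (θ : ℝ) : ℝ :=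
  if θ = 0 then (c0 / (2 * Real.pi)) ^ 2
  else c0 * J1 (θ * c0 / Real.pi) / (2 * Real.pi * θ)

theorem integral_sub_pow_mul_pow (θ : ℝ) (m n : ℕ) :
    ∫ α in (0 : ℝ)..θ, (θ - α) ^ m * α ^ n =
      θ ^ (m + n + 1) * ((m.factorial : ℝ) * n.factorial / (m + n + 1).factorial) := by
  induction n generalizing m with
  | zero =>
    have h := intervalIntegral.integral_comp_sub_left (a := 0) (b := θ) (fun x : ℝ => x ^ m) θ
    simp only [pow_zero, mul_one]
    rw [h, sub_self, sub_zero, integral_pow]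
    have : (m.factorial : ℝ) ≠ 0 := by positivity
    simp only [add_zero, Nat.factorial_succ, Nat.factorial_zero]
    push_cast
    field_simp
    simp
  | succ n ih =>
    have hv : ∀ x ∈ Set.uIcc 0 θ,
        HasDerivAt (fun x : ℝ => -(θ - x) ^ (m + 1) / (m + 1)) ((θ - x) ^ m) x := by
      intro x _
      have h := (((hasDerivAt_id x).const_sub θ).pow (m + 1)).neg.div_const ((m : ℝ) + 1)
      refine h.congr_deriv ?_
      simp only [id, Nat.add_sub_cancel]
      push_cast
      field_simp
    have hu : ∀ x ∈ Set.uIcc 0 θ,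
        HasDerivAt (fun x : ℝ => x ^ (n + 1)) ((n + 1 : ℝ) * x ^ n) x := by
      intro x _
      simpa using hasDerivAt_pow (n + 1) x
    have h := intervalIntegral.integral_mul_deriv_eq_deriv_mul hu hv
      (Continuous.intervalIntegrable (by fun_prop) _ _)
      (Continuous.intervalIntegrable (by fun_prop) _ _)
    have h2 : ∫ x in (0 : ℝ)..θ, (n + 1 : ℝ) * x ^ n * (-(θ - x) ^ (m + 1) / (m + 1)) =
        -((n + 1 : ℝ) / (m + 1)) * ∫ x in (0 : ℝ)..θ, (θ - x) ^ (m + 1) * x ^ n := by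
      rw [← intervalIntegral.integral_const_mul]
      congr 1
      ext x
      ring
    rw [h2, ih] at h
    simp_rw [mul_comm ((θ - _) ^ m)]
    rw [h]
    have e : m + 1 + n + 1 = m + (n + 1) + 1 := by ring
    rw [e, Nat.factorial_succ m, Nat.factorial_succ n]
    push_cast
    have : ((m : ℝ) + 1) ≠ 0 := by positivity
    field_simp
    simp

theorem intervalIntegral_triangle_swap {h : ℝ → ℝ → ℝ} (hh : Continuous (Function.uncurry h))
    {θ : ℝ} (hθ : 0 ≤ θ) :
    ∫ α in (0 : ℝ)..θ, ∫ β in (0 : ℝ)..α, h α β =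
      ∫ β in (0 : ℝ)..θ, ∫ α in β..θ, h α β := by
  have hS : MeasurableSet {p : ℝ × ℝ | p.2 ≤ p.1} := measurableSet_le measurable_snd measurable_fst
  have h1 : ∫ α in (0 : ℝ)..θ, ∫ β in (0 : ℝ)..α, h α β =
      ∫ α in (0 : ℝ)..θ, ∫ β in (0 : ℝ)..θ,
        Set.indicator {p : ℝ × ℝ | p.2 ≤ p.1} (Function.uncurry h) (α, β) := by
    refine intervalIntegral.integral_congr fun α hα => ?_
    rw [Set.uIcc_of_le hθ] at hα
    exact (intervalIntegral.integral_indicator (f := h α) hα).symm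
  have h2 : ∫ β in (0 : ℝ)..θ, ∫ α in β..θ, h α β =
      ∫ β in (0 : ℝ)..θ, ∫ α in (0 : ℝ)..θ,
        Set.indicator {p : ℝ × ℝ | p.2 ≤ p.1} (Function.uncurry h) (α, β) := by
    refine intervalIntegral.integral_congr_ae (Filter.Eventually.of_forall fun β hβ => ?_)
    rw [Set.uIoc_of_le hθ] at hβ
    have e : ∀ α, Set.indicator {p : ℝ × ℝ | p.2 ≤ p.1} (Function.uncurry h) (α, β) =
        Set.indicator (Set.Ici β) (fun α => h α β) α := fun α => by
      simp [Set.indicator]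
    simp_rw [e]
    rw [intervalIntegral.integral_of_le hθ, intervalIntegral.integral_of_le hβ.2,
      setIntegral_indicator measurableSet_Ici, ← integral_Icc_eq_integral_Ioc]
    congr 2
    ext x
    simp only [Set.mem_Icc, Set.mem_inter_iff, Set.mem_Ioc, Set.mem_Ici]
    constructor
    · rintro ⟨ha, hb⟩
      exact ⟨⟨hβ.1.trans_le ha, hb⟩, ha⟩
    · rintro ⟨⟨-, hb⟩, ha⟩
      exact ⟨ha, hb⟩
  rw [h1, h2]
  refine intervalIntegral_intervalIntegral_swap
    (F := fun α β => Set.indicator {p : ℝ × ℝ | p.2 ≤ p.1} (Function.uncurry h) (α, β)) ?_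
  refine Integrable.indicator ?_ hS
  exact (hh.continuousOn.integrableOn_compact (isCompact_uIcc.prod isCompact_uIcc)).mono_set
    (Set.prod_mono Set.uIoc_subset_uIcc Set.uIoc_subset_uIcc)

theorem two_mul_sum_catalan_mul_centralBinom (n : ℕ) :
    2 * ∑ x ∈ Finset.HasAntidiagonal.antidiagonal n, catalan x.1 * Nat.centralBinom x.2 =
      Nat.centralBinom (n + 1) := by
  have hs : ∑ x ∈ Finset.HasAntidiagonal.antidiagonal n, catalan x.1 * Nat.centralBinom x.2 =
      ∑ x ∈ Finset.HasAntidiagonal.antidiagonal n, catalan x.2 * Nat.centralBinom x.1 := by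
    rw [← Finset.Nat.sum_antidiagonal_swap]
    rfl
  rw [two_mul]
  nth_rewrite 2 [hs]
  rw [← Finset.sum_add_distrib, ← succ_mul_catalan_eq_centralBinom, catalan_succ', Finset.mul_sum]
  refine Finset.sum_congr rfl fun x hx => ?_
  rw [Finset.HasAntidiagonal.mem_antidiagonal] at hx
  rw [← succ_mul_catalan_eq_centralBinom, ← succ_mul_catalan_eq_centralBinom, ← hx]
  ring

/-- Taylor coefficients of `J₀(a t)` in `t ^ 2`. -/
noncomputable def besselCoeff (a : ℝ) (k : ℕ) : ℝ :=
  (-1) ^ k * (a / 2) ^ (2 * k) / (k.factorial : ℝ) ^ 2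

/-- Taylor coefficients of `a J₁(a t) / t` in `t ^ 2`. -/
noncomputable def besselQuotCoeff (a : ℝ) (k : ℕ) : ℝ :=
  (-1) ^ k * (a ^ 2 / 2) * (a / 2) ^ (2 * k) / ((k.factorial : ℝ) * ((k + 1).factorial : ℝ))

theorem summable_abs_besselCoeff (a R : ℝ) :
    Summable fun k => |besselCoeff a k| * R ^ (2 * k) := by
  refine Summable.of_nonneg_of_le (fun k => ?_) (fun k => ?_)
    (Real.summable_pow_div_factorial ((a / 2 * R) ^ 2))
  · rw [pow_mul]; positivity
  · rw [besselCoeff, abs_div, abs_mul, abs_pow, abs_neg, abs_one, one_pow, one_mul,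
      abs_of_nonneg (by rw [pow_mul]; positivity), abs_of_nonneg (by positivity), div_mul_eq_mul_div,
      ← mul_pow, pow_mul]
    have h1 : (1 : ℝ) ≤ k.factorial := by exact_mod_cast k.factorial_pos
    gcongr
    exact le_self_pow₀ h1 two_ne_zero

theorem summable_abs_besselQuotCoeff (a R : ℝ) :
    Summable fun k => |besselQuotCoeff a k| * R ^ (2 * k) := by
  refine Summable.of_nonneg_of_le (fun k => ?_) (fun k => ?_)
    ((Real.summable_pow_div_factorial ((a / 2 * R) ^ 2)).mul_left (a ^ 2 / 2))
  · rw [pow_mul]; positivity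
  · rw [besselQuotCoeff, abs_div, abs_mul, abs_mul, abs_pow, abs_neg, abs_one, one_pow, one_mul,
      abs_of_nonneg (a := a ^ 2 / 2) (by positivity),
      abs_of_nonneg (a := (a / 2) ^ (2 * k)) (by rw [pow_mul]; positivity),
      abs_of_nonneg (by positivity), div_mul_eq_mul_div,
      mul_assoc, ← mul_pow, pow_mul, ← mul_div_assoc]
    have h1 : (1 : ℝ) ≤ (k + 1).factorial := by exact_mod_cast (k + 1).factorial_pos
    gcongr
    exact le_mul_of_one_le_right (by positivity) h1

theorem hasSum_even_of_summable {c : ℕ → ℝ} (hc : ∀ R, Summable fun k => |c k| * R ^ (2 * k))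
    (x : ℝ) : HasSum (fun k => c k * x ^ (2 * k)) (∑' k, c k * x ^ (2 * k)) := by
  refine Summable.hasSum (Summable.of_norm ?_)
  refine (hc |x|).congr fun k => ?_
  simp

theorem continuous_even_tsum {c : ℕ → ℝ} (hc : ∀ R, Summable fun k => |c k| * R ^ (2 * k)) :
    Continuous fun x : ℝ => ∑' k, c k * x ^ (2 * k) := by
  refine continuous_iff_continuousAt.2 fun x => ?_
  have h : ContinuousOn (fun x : ℝ => ∑' k, c k * x ^ (2 * k)) (Metric.ball 0 (|x| + 1)) := by
    refine continuousOn_tsum (fun k => by fun_prop) (hc (|x| + 1)) fun k y hy => ?_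
    rw [norm_mul, norm_pow, Real.norm_eq_abs]
    gcongr
    exact (mem_ball_zero_iff.1 hy).le
  exact h.continuousAt (Metric.isOpen_ball.mem_nhds (by simp))

theorem hasDerivAt_besselCoeff_tsum (a x : ℝ) :
    HasDerivAt (fun x : ℝ => ∑' k, besselCoeff a k * x ^ (2 * k))
      (-x * ∑' k, besselQuotCoeff a k * x ^ (2 * k)) x := by
  set R := |x| + 1 with hR
  have hb : Summable fun k => R * (|besselQuotCoeff a k| * R ^ (2 * k)) :=
    (summable_abs_besselQuotCoeff a R).mul_left R
  have hd : ∀ k y, HasDerivAt (fun y : ℝ => besselCoeff a (k + 1) * y ^ (2 * (k + 1)))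
      (-y * (besselQuotCoeff a k * y ^ (2 * k))) y := by
    intro k y
    have h := (hasDerivAt_pow (2 * (k + 1)) y).const_mul (besselCoeff a (k + 1))
    refine h.congr_deriv ?_
    simp only [besselCoeff, besselQuotCoeff]
    rw [show 2 * (k + 1) - 1 = 2 * k + 1 by omega,
      Nat.factorial_succ]
    push_cast
    field_simp
    ring
  have h := hasDerivAt_tsum_of_isPreconnected (y₀ := x) (y := x) (t := Metric.ball 0 R) hb
    Metric.isOpen_ball
    (convex_ball 0 R).isPreconnected (fun k y _ => hd k y) (fun k y hy => ?_) (by simp [hR])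
    ((summable_nat_add_iff 1).2 (hasSum_even_of_summable (summable_abs_besselCoeff a) x).summable)
    (by simp [hR])
  · rw [tsum_mul_left] at h
    refine (h.const_add (besselCoeff a 0)).congr_of_eventuallyEq
      (Filter.Eventually.of_forall fun y => ?_)
    simpa using
      (hasSum_even_of_summable (summable_abs_besselCoeff a) y).summable.tsum_eq_zero_add
  · have hy' := (mem_ball_zero_iff.1 hy).le
    rw [norm_mul, norm_neg, norm_mul, norm_pow, Real.norm_eq_abs (besselQuotCoeff a k)]
    gcongr

theorem hasSum_convolution_even {c d : ℕ → ℝ}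
    (hc : ∀ R, Summable fun k => |c k| * R ^ (2 * k))
    (hd : ∀ R, Summable fun k => |d k| * R ^ (2 * k)) {θ : ℝ} (hθ : 0 ≤ θ) :
    HasSum (fun x : ℕ × ℕ => c x.1 * d x.2 * (θ ^ (2 * x.1 + 2 * x.2 + 1) *
        (((2 * x.1).factorial : ℝ) * (2 * x.2).factorial / (2 * x.1 + 2 * x.2 + 1).factorial)))
      (∫ α in (0 : ℝ)..θ, (∑' k, c k * (θ - α) ^ (2 * k)) * ∑' k, d k * α ^ (2 * k)) := by
  have hs : ∀ x y : ℝ, Summable fun z : ℕ × ℕ => c z.1 * x ^ (2 * z.1) * (d z.2 * y ^ (2 * z.2)) :=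
    fun x y => summable_mul_of_summable_norm (f := fun k => c k * x ^ (2 * k))
      (g := fun k => d k * y ^ (2 * k)) ((hc |x|).congr fun k => by simp)
      ((hd |y|).congr fun k => by simp)
  have h := intervalIntegral.hasSum_integral_of_dominated_convergence (μ := volume) (a := 0) (b := θ)
    (F := fun (z : ℕ × ℕ) α => c z.1 * (θ - α) ^ (2 * z.1) * (d z.2 * α ^ (2 * z.2)))
    (f := fun α => (∑' k, c k * (θ - α) ^ (2 * k)) * ∑' k, d k * α ^ (2 * k))
    (fun z _ => ‖c z.1 * θ ^ (2 * z.1) * (d z.2 * θ ^ (2 * z.2))‖)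
    (fun z => (by fun_prop : Continuous _).aestronglyMeasurable)
    (fun z => Filter.Eventually.of_forall fun α hα => ?_)
    (Filter.Eventually.of_forall fun α _ => (hs θ θ).norm)
    (by simp) (Filter.Eventually.of_forall fun α _ =>
      (hasSum_even_of_summable hc _).mul (hasSum_even_of_summable hd _) (hs _ _))
  · refine (congrArg (HasSum · _) (funext fun z => ?_)).mp h
    rw [← integral_sub_pow_mul_pow, ← intervalIntegral.integral_const_mul]
    congr 1
    ext α
    ring
  · rw [Set.uIoc_of_le hθ] at hα
    simp only [norm_mul, norm_pow]
    gcongr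
    · rw [Real.norm_of_nonneg (by linarith [hα.2]), Real.norm_of_nonneg hθ]
      linarith [hα.1]
    · rw [Real.norm_of_nonneg hα.1.le, Real.norm_of_nonneg hθ]
      exact hα.2

theorem sum_antidiagonal_bessel (a : ℝ) (n : ℕ) :
    ∑ x ∈ Finset.HasAntidiagonal.antidiagonal n, besselQuotCoeff a x.1 * besselCoeff a x.2 *
      (((2 * x.1).factorial : ℝ) * (2 * x.2).factorial) =
      besselQuotCoeff a n * (2 * n + 1).factorial := by
  have hB : ∀ j : ℕ, ((2 * j).factorial : ℝ) = Nat.centralBinom j * (j.factorial : ℝ) ^ 2 := by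
    intro j
    have h := Nat.choose_mul_factorial_mul_factorial (show j ≤ 2 * j by omega)
    rw [show 2 * j - j = j by omega, ← Nat.centralBinom_eq_two_mul_choose] at h
    rw [← h]
    push_cast
    ring
  have hC : ∀ i : ℕ, ((2 * i).factorial : ℝ) =
      catalan i * ((i.factorial : ℝ) * (i + 1).factorial) := by
    intro i
    rw [hB, ← succ_mul_catalan_eq_centralBinom, Nat.factorial_succ]
    push_cast
    ring
  have hn : ((2 * n + 1).factorial : ℝ) * 2 =
      Nat.centralBinom (n + 1) * ((n.factorial : ℝ) * (n + 1).factorial) := by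
    have h := hB (n + 1)
    rw [show 2 * (n + 1) = 2 * n + 1 + 1 by ring, Nat.factorial_succ (2 * n + 1),
      Nat.factorial_succ n] at h
    rw [Nat.factorial_succ n]
    push_cast at h ⊢
    have h1 : (n : ℝ) + 1 ≠ 0 := by positivity
    apply mul_left_cancel₀ h1
    linear_combination h
  have ht : ∀ x ∈ Finset.HasAntidiagonal.antidiagonal n,
      besselQuotCoeff a x.1 * besselCoeff a x.2 *
        (((2 * x.1).factorial : ℝ) * (2 * x.2).factorial) =
      (-1) ^ n * (a ^ 2 / 2) * (a / 2) ^ (2 * n) *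
        ((catalan x.1 * Nat.centralBinom x.2 : ℕ) : ℝ) := by
    intro x hx
    rw [Finset.HasAntidiagonal.mem_antidiagonal] at hx
    rw [hC x.1, hB x.2, ← hx, besselQuotCoeff, besselCoeff]
    have h1 : (x.1.factorial : ℝ) ≠ 0 := by positivity
    have h2 : (x.2.factorial : ℝ) ≠ 0 := by positivity
    have h3 : ((x.1 + 1).factorial : ℝ) ≠ 0 := by positivity
    push_cast
    field_simp
    ring
  rw [Finset.sum_congr rfl ht, ← Finset.mul_sum, ← Nat.cast_sum]
  have hs := two_mul_sum_catalan_mul_centralBinom n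
  have hs' : (2 : ℝ) * ((∑ x ∈ Finset.HasAntidiagonal.antidiagonal n,
      catalan x.1 * Nat.centralBinom x.2 : ℕ) : ℝ) = Nat.centralBinom (n + 1) := by
    exact_mod_cast hs
  rw [← hs'] at hn
  rw [besselQuotCoeff]
  have h1 : (n.factorial : ℝ) ≠ 0 := by positivity
  have h3 : ((n + 1).factorial : ℝ) ≠ 0 := by positivity
  rw [div_mul_eq_mul_div, eq_div_iff (mul_ne_zero h1 h3)]
  linear_combination (-(1 / 2) * ((-1) ^ n * (a ^ 2 / 2) * (a / 2) ^ (2 * n))) * hn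

theorem convolution_besselQuot_bessel (a : ℝ) {θ : ℝ} (hθ : 0 ≤ θ) :
    ∫ α in (0 : ℝ)..θ, (∑' k, besselQuotCoeff a k * (θ - α) ^ (2 * k)) *
        ∑' k, besselCoeff a k * α ^ (2 * k) =
      θ * ∑' k, besselQuotCoeff a k * θ ^ (2 * k) := by
  have h := hasSum_convolution_even (summable_abs_besselQuotCoeff a) (summable_abs_besselCoeff a) hθ
  have h2 := ((Finset.HasAntidiagonal.sigmaAntidiagonalEquivProd (A := ℕ)).hasSum_iff.2 h).sigma
    (fun n => hasSum_fintype _)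
  refine h2.unique ((congrArg (HasSum · _) (funext fun n => ?_)).mpr
    ((hasSum_even_of_summable (summable_abs_besselQuotCoeff a) θ).mul_left θ))
  have hf : ((2 * n + 1).factorial : ℝ) ≠ 0 := by positivity
  simp only [Function.comp_apply, Finset.HasAntidiagonal.sigmaAntidiagonalEquivProd_apply]
  rw [Finset.univ_eq_attach, Finset.sum_attach (Finset.HasAntidiagonal.antidiagonal n)
    (fun x : ℕ × ℕ => besselQuotCoeff a x.1 * besselCoeff a x.2 * (θ ^ (2 * x.1 + 2 * x.2 + 1) *
        (((2 * x.1).factorial : ℝ) * (2 * x.2).factorial / (2 * x.1 + 2 * x.2 + 1).factorial)))]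
  have e : besselQuotCoeff a n =
      (besselQuotCoeff a n * (2 * n + 1).factorial) / (2 * n + 1).factorial := by
    field_simp
  rw [e, ← sum_antidiagonal_bessel, Finset.sum_div, Finset.sum_mul, Finset.mul_sum]
  refine Finset.sum_congr rfl fun x hx => ?_
  rw [Finset.HasAntidiagonal.mem_antidiagonal] at hx
  rw [← hx, mul_add]
  ring

theorem hasDerivAt_convolution {u w g : ℝ → ℝ} (hu : ∀ t, HasDerivAt u (w t) t)
    (hw : Continuous w) (hg : Continuous g) {θ : ℝ} (hθ : 0 < θ) :
    HasDerivAt (fun s => ∫ α in (0 : ℝ)..s, u (s - α) * g α)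
      (u 0 * g θ + ∫ α in (0 : ℝ)..θ, w (θ - α) * g α) θ := by
  have huc : Continuous u := continuous_iff_continuousAt.2 fun t => (hu t).continuousAt
  have hH : Continuous fun s => ∫ α in (0 : ℝ)..s, w (s - α) * g α :=
    intervalIntegral.continuous_parametric_intervalIntegral_of_continuous
      (by fun_prop) continuous_id
  have hH' : Continuous fun s => u 0 * g s + ∫ α in (0 : ℝ)..s, w (s - α) * g α := by fun_prop
  refine (intervalIntegral.integral_hasDerivAt_right (hH'.intervalIntegrable 0 θ)
    (hH'.stronglyMeasurableAtFilter _ _) hH'.continuousAt).congr_of_eventuallyEq ?_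
  filter_upwards [lt_mem_nhds hθ] with s hs
  rw [intervalIntegral.integral_add (Continuous.intervalIntegrable (by fun_prop) _ _)
    (hH.intervalIntegrable _ _),
    intervalIntegral_triangle_swap (h := fun t β => w (t - β) * g β) (by fun_prop) hs.le,
    ← intervalIntegral.integral_add (Continuous.intervalIntegrable (by fun_prop) _ _)]
  · refine intervalIntegral.integral_congr fun β _ => ?_
    have h1 : ∫ t in β..s, w (t - β) = u (s - β) - u 0 := by
      rw [intervalIntegral.integral_comp_sub_right w β, sub_self]
      exact intervalIntegral.integral_eq_sub_of_hasDerivAt (fun t _ => hu t)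
        (hw.intervalIntegrable _ _)
    simp only [intervalIntegral.integral_mul_const, h1]
    ring
  · have h1 : ∀ β, ∫ t in β..s, w (t - β) * g β = (u (s - β) - u 0) * g β := by
      intro β
      rw [intervalIntegral.integral_mul_const, intervalIntegral.integral_comp_sub_right w β,
        sub_self, intervalIntegral.integral_eq_sub_of_hasDerivAt (fun t _ => hu t)
        (hw.intervalIntegrable _ _)]
    simp_rw [h1]
    exact Continuous.intervalIntegrable (by fun_prop) _ _

theorem convolution_assoc {k u g : ℝ → ℝ} (hk : Continuous k) (hu : Continuous u)
    (hg : Continuous g) {θ : ℝ} (hθ : 0 ≤ θ) :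
    ∫ α in (0 : ℝ)..θ, k (θ - α) * ∫ β in (0 : ℝ)..α, u (α - β) * g β =
      ∫ β in (0 : ℝ)..θ, (∫ τ in (0 : ℝ)..(θ - β), k (θ - β - τ) * u τ) * g β := by
  simp_rw [← intervalIntegral.integral_const_mul]
  rw [intervalIntegral_triangle_swap (h := fun α β => k (θ - α) * (u (α - β) * g β))
    (by fun_prop) hθ]
  refine intervalIntegral.integral_congr fun β _ => ?_
  have h := intervalIntegral.integral_comp_sub_right (a := β) (b := θ)
    (fun τ => k (θ - β - τ) * u τ) β
  rw [sub_self] at h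
  simp only [← h, ← intervalIntegral.integral_mul_const]
  refine intervalIntegral.integral_congr fun α _ => ?_
  simp only [sub_sub_sub_cancel_right]
  ring

theorem Finf_eq_tsum (θ : ℝ) :
    Finf θ = ∑' k, besselCoeff (c0 / π) k * θ ^ (2 * k) := by
  rw [Finf, J0]
  refine tsum_congr fun k => ?_
  rw [besselCoeff, show θ * c0 / π / 2 = c0 / π / 2 * θ by ring, mul_pow]
  ring

theorem two_mul_F_eq_tsum (θ : ℝ) :
    2 * F θ = ∑' k, besselQuotCoeff (c0 / π) k * θ ^ (2 * k) := by
  have hπ := Real.pi_ne_zero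
  rw [F]
  split_ifs with h
  · rw [tsum_eq_single 0 (fun k hk => by simp [h, hk])]
    simp [besselQuotCoeff]
    field_simp
  · rw [J1, ← tsum_mul_left, ← tsum_div_const, ← tsum_mul_left]
    refine tsum_congr fun k => ?_
    rw [besselQuotCoeff, show θ * c0 / π / 2 = c0 / π / 2 * θ by ring, mul_pow, pow_succ, pow_succ]
    field_simp

theorem continuous_Finf : Continuous Finf := by
  rw [funext Finf_eq_tsum]
  exact continuous_even_tsum (summable_abs_besselCoeff _)

theorem continuous_two_mul_F : Continuous fun θ => 2 * F θ := by
  rw [funext two_mul_F_eq_tsum]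
  exact continuous_even_tsum (summable_abs_besselQuotCoeff _)

theorem hasDerivAt_Finf (θ : ℝ) : HasDerivAt Finf (-θ * (2 * F θ)) θ := by
  rw [funext Finf_eq_tsum, two_mul_F_eq_tsum]
  exact hasDerivAt_besselCoeff_tsum _ _

theorem convolution_F_Finf {θ : ℝ} (hθ : 0 ≤ θ) :
    ∫ α in (0 : ℝ)..θ, 2 * F (θ - α) * Finf α = θ * (2 * F θ) := by
  simp_rw [two_mul_F_eq_tsum, Finf_eq_tsum]
  exact convolution_besselQuot_bessel _ hθ

theorem J0_zero : J0 0 = 1 := by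
  rw [J0, tsum_eq_single 0 (fun k hk => by simp [hk])]
  simp

theorem Finf_zero : Finf 0 = 1 := by
  simp [Finf, J0_zero]

theorem Finf_ne_zero {θ : ℝ} (h0 : 0 ≤ θ) (hθ : θ < π) : Finf θ ≠ 0 := by
  intro h
  have hc : 0 ≤ c0 := Real.sInf_nonneg fun x hx => hx.1.le
  have hx : 0 ≤ θ * c0 / π := by positivity
  rcases hx.eq_or_lt with hx | hx
  · rw [Finf, ← hx, J0_zero] at h
    exact one_ne_zero h
  · have hle : c0 ≤ θ * c0 / π := csInf_le ⟨0, fun y hy => hy.1.le⟩ ⟨hx, h⟩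
    have hc' : 0 < c0 := hc.lt_of_ne fun h' => by simp [← h'] at hx
    rw [le_div_iff₀ Real.pi_pos] at hle
    nlinarith

theorem hasDerivAt_convolution_Finf {g : ℝ → ℝ} (hg : Continuous g) {θ : ℝ} (hθ : 0 < θ) :
    HasDerivAt (fun s => ∫ α in (0 : ℝ)..s, Finf (s - α) * g α)
      (g θ - ∫ α in (0 : ℝ)..θ, 2 * F (θ - α) * ∫ β in (0 : ℝ)..α, Finf (α - β) * g β) θ := by
  have hK := continuous_two_mul_F
  have h := hasDerivAt_convolution hasDerivAt_Finf (by fun_prop) hg hθ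
  refine h.congr_deriv ?_
  rw [Finf_zero, one_mul, sub_eq_add_neg,
    convolution_assoc (k := fun t => 2 * F t) hK continuous_Finf hg hθ.le,
    ← intervalIntegral.integral_neg]
  congr 1
  refine intervalIntegral.integral_congr fun β hβ => ?_
  rw [Set.uIcc_of_le hθ.le] at hβ
  rw [convolution_F_Finf (sub_nonneg.2 hβ.2)]
  ring

/-- Equation (eq:poissonsolution) in the proof of Proposition 4.7: with `f` continuous
on `[0,π]` and `φ(θ) = -(1/F_∞(θ)) ∫₀^θ F_∞(θ−α) F_∞(α) f(α) dα`, the function `φ` is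
differentiable on `(0,π)` and solves the Poisson equation
`φ′(θ) + ∫₀^θ 2 F(θ−α) (F_∞(α)/F_∞(θ)) (φ(α) − φ(θ)) dα = −f(θ)`. -/
theorem poisson_equation_solution (f : ℝ → ℝ)
    (hf : ContinuousOn f (Set.Icc 0 Real.pi)) :
    ∀ θ ∈ Set.Ioo (0 : ℝ) Real.pi,
      HasDerivAt
        (fun θ : ℝ => -(1 / Finf θ) * ∫ α in (0:ℝ)..θ, Finf (θ - α) * Finf α * f α)
        (-f θ - ∫ α in (0:ℝ)..θ, 2 * F (θ - α) * (Finf α / Finf θ) *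
          ((-(1 / Finf α) * ∫ β in (0:ℝ)..α, Finf (α - β) * Finf β * f β) -
            (-(1 / Finf θ) * ∫ β in (0:ℝ)..θ, Finf (θ - β) * Finf β * f β)))
        θ := by
  intro θ hθ
  set g : ℝ → ℝ := fun α => Finf α * Set.IccExtend Real.pi_pos.le (Set.domRestrict _ f) α with hgdef
  have hg : Continuous g := continuous_Finf.mul (hf.domRestrict.Icc_extend')
  have hgf : ∀ s, 0 ≤ s → s ≤ π → ∫ β in (0:ℝ)..s, Finf (s - β) * Finf β * f β =
      ∫ β in (0:ℝ)..s, Finf (s - β) * g β := by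
    intro s h0 hs
    refine intervalIntegral.integral_congr fun β hβ => ?_
    rw [Set.uIcc_of_le h0] at hβ
    simp only [hgdef]
    rw [Set.IccExtend_of_mem _ _ ⟨hβ.1, hβ.2.trans hs⟩]
    rw [mul_assoc]
    rfl
  set G : ℝ → ℝ := fun s => ∫ β in (0:ℝ)..s, Finf (s - β) * g β 
  have hK := continuous_two_mul_F
  have hKθ : Continuous fun α => 2 * F (θ - α) := hK.comp (continuous_const.sub continuous_id)
  have hGc : Continuous G := intervalIntegral.continuous_parametric_intervalIntegral_of_continuous
    (by have := continuous_Finf; fun_prop) continuous_id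
  have hne : Finf θ ≠ 0 := Finf_ne_zero hθ.1.le hθ.2
  have hderiv := ((hasDerivAt_Finf θ).inv hne).neg.mul (hasDerivAt_convolution_Finf hg hθ.1)
  have hint : ∫ α in (0:ℝ)..θ, 2 * F (θ - α) * (Finf α / Finf θ) *
          ((-(1 / Finf α) * ∫ β in (0:ℝ)..α, Finf (α - β) * Finf β * f β) -
            (-(1 / Finf θ) * ∫ β in (0:ℝ)..θ, Finf (θ - β) * Finf β * f β)) =
      G θ / Finf θ ^ 2 * (θ * (2 * F θ)) -
        1 / Finf θ * ∫ α in (0:ℝ)..θ, 2 * F (θ - α) * G α := by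
    have h1 : IntervalIntegrable (fun α => G θ / Finf θ ^ 2 * (2 * F (θ - α) * Finf α))
        volume 0 θ :=
      (continuous_const.mul (hKθ.mul continuous_Finf)).intervalIntegrable _ _
    have h2 : IntervalIntegrable (fun α => 1 / Finf θ * (2 * F (θ - α) * G α)) volume 0 θ :=
      (continuous_const.mul (hKθ.mul hGc)).intervalIntegrable _ _
    rw [← convolution_F_Finf hθ.1.le, ← intervalIntegral.integral_const_mul (G θ / Finf θ ^ 2),
      ← intervalIntegral.integral_const_mul (1 / Finf θ) (fun α => 2 * F (θ - α) * G α),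
      ← intervalIntegral.integral_sub h1 h2]
    refine intervalIntegral.integral_congr fun α hα => ?_
    rw [Set.uIcc_of_le hθ.1.le] at hα
    have hα' : Finf α ≠ 0 := Finf_ne_zero hα.1 (hα.2.trans_lt hθ.2)
    rw [hgf α hα.1 (hα.2.trans hθ.2.le), hgf θ hθ.1.le hθ.2.le]
    change _ * ((-(1 / Finf α) * G α) - (-(1 / Finf θ) * G θ)) = _
    field_simp
    ring
  rw [hint]
  have hgθ : g θ = Finf θ * f θ := by
    simp only [hgdef]
    rw [Set.IccExtend_of_mem _ _ ⟨hθ.1.le, hθ.2.le⟩]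
    rfl
  refine (hderiv.congr_deriv ?_).congr_of_eventuallyEq ?_
  · rw [hgθ]
    change _ * G θ + _ * (_ - ∫ α in (0:ℝ)..θ, 2 * F (θ - α) * G α) = _
    simp only [Pi.neg_apply, Pi.inv_apply]
    field_simp
    ring
  · filter_upwards [Ioo_mem_nhds hθ.1 hθ.2] with s hs
    rw [hgf s hs.1.le hs.2.le]
    simp
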